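/- arXiv:1511.04866 — 3 statements merged into one kernel-verified Lean document; each statement's English description precedes it below -/
import Mathlib

section
/- Let A → B be a local homomorphism of Noetherian local rings, let κ be the residue field of A, let b be an element of the maximal ideal of B, and let b̄ denote the residue class of b in B ⊗_A κ. Then the following two conditions are equivalent: (1) the quotient B/bB is flat over A and b is a non-zero-divisor of B; (2) B is flat over A and b̄ is a non-zero-divisor of B ⊗_A κ. -/
section

open TensorProduct IsLocalRing

/-- Multiplication by `b` on a base change is injective for every module of finite length over a
local ring, as soon as it is so for the residue field. -/
theorem IsSMulRegular.tensorProduct_of_isFiniteLength {A B : Type*} [CommRing A] [CommRing B]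
    [IsLocalRing A] [Algebra A B] [Module.Flat A B] {b : B}
    (hb : IsSMulRegular (B ⊗[A] ResidueField A) b) {N : Type*} [AddCommGroup N] [Module A N]
    (hN : IsFiniteLength A N) : IsSMulRegular (B ⊗[A] N) b := by
  induction hN with
  | of_subsingleton => exact fun _ _ _ ↦ Subsingleton.elim _ _
  | @of_simple_quotient M _ _ N hs _ ih =>
    obtain ⟨m, hm, ⟨e⟩⟩ := isSimpleModule_iff_quot_maximal.mp hs
    obtain rfl := eq_maximalIdeal hm
    refine isSMulRegular_of_range_eq_ker (f := AlgebraTensorModule.lTensor B B N.subtype)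
      (g := AlgebraTensorModule.lTensor B B N.mkQ) ?_ ?_ ih ?_
    · exact Module.Flat.lTensor_preserves_injective_linearMap _ N.subtype_injective
    · exact SetLike.ext fun x ↦ (_root_.lTensor_exact B (LinearMap.exact_subtype_mkQ N)
        N.mkQ_surjective x).symm
    · exact ((AlgebraTensorModule.congr (LinearEquiv.refl B B) e).isSMulRegular_congr b).mpr hb

theorem IsLocalRing.isFiniteLength_quotient_of_maximalIdeal_pow_le {A : Type*} [CommRing A]
    [IsNoetherianRing A] [IsLocalRing A] {J : Ideal A} {n : ℕ} (h : maximalIdeal A ^ n ≤ J) :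
    IsFiniteLength A (A ⧸ J) := by
  by_cases hJ : J = ⊤
  · have : Subsingleton (A ⧸ J) := Ideal.Quotient.subsingleton_iff.mpr hJ
    exact .of_subsingleton
  have : IsArtinianRing (A ⧸ J) :=
    quotient_artinian_of_mem_minimalPrimes_of_isLocalRing J
      ⟨⟨inferInstance, le_maximalIdeal hJ⟩, fun p hp _ ↦ hp.1.le_of_pow_le (h.trans hp.2)⟩
  exact isFiniteLength_iff_isNoetherian_isArtinian.mpr ⟨inferInstance,
    isArtinian_of_surjective_algebraMap (Ideal.Quotient.mk_surjective (I := J))⟩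

/-- If `b` is regular on the closed fibre, it is regular modulo every ideal of the base. -/
theorem mem_map_of_mul_mem_map_of_flat {A B : Type*} [CommRing A] [CommRing B]
    [IsNoetherianRing A] [IsNoetherianRing B] [IsLocalRing A] [IsLocalRing B] [Algebra A B]
    [IsLocalHom (algebraMap A B)] [Module.Flat A B] {b : B}
    (hb : IsSMulRegular (B ⊗[A] ResidueField A) b) (I : Ideal A) {c : B}
    (hc : b * c ∈ I.map (algebraMap A B)) : c ∈ I.map (algebraMap A B) := by
  have key (n : ℕ) : c ∈ (I ⊔ maximalIdeal A ^ n).map (algebraMap A B) := by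
    have h := IsSMulRegular.tensorProduct_of_isFiniteLength hb
      (isFiniteLength_quotient_of_maximalIdeal_pow_le
        (le_sup_right (a := I) (b := maximalIdeal A ^ n)))
    rw [← (Ideal.qoutMapEquivTensorQout B).isSMulRegular_congr] at h
    exact mem_of_isSMulRegular_quotient_of_smul_mem h (Ideal.map_mono le_sup_left hc)
  have hm : (maximalIdeal A).map (algebraMap A B) ≠ ⊤ := by
    have hle : (maximalIdeal A).map (algebraMap A B) ≤ maximalIdeal B :=
      ((local_hom_TFAE (algebraMap A B)).out 0 2).mp ‹_›
    exact (hle.trans_lt (maximalIdeal.isMaximal B).ne_top.lt_top).ne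
  have hK := Ideal.iInf_pow_smul_eq_bot_of_isLocalRing (M := B ⧸ I.map (algebraMap A B)) _ hm
  rw [← Ideal.Quotient.eq_zero_iff_mem, ← Submodule.mem_bot B, ← hK, Submodule.mem_iInf]
  intro n
  have := key n
  rw [Ideal.map_sup, Ideal.map_pow] at this
  obtain ⟨x, hx, y, hy, rfl⟩ := Submodule.mem_sup.mp this
  rw [map_add, Ideal.Quotient.eq_zero_iff_mem.mpr hx, zero_add]
  simpa [Algebra.smul_def] using
    Submodule.smul_mem_smul hy (Submodule.mem_top (x := (1 : B ⧸ I.map (algebraMap A B))))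

theorem exact_mulLeft_mkₐ {A B : Type*} [CommRing A] [CommRing B] [Algebra A B] (b : B) :
    Function.Exact (LinearMap.mulLeft A b)
      (Ideal.Quotient.mkₐ A (Ideal.span {b})).toLinearMap := fun c ↦ by
  rw [AlgHom.toLinearMap_apply, Ideal.Quotient.mkₐ_eq_mk, Ideal.Quotient.eq_zero_iff_mem,
    Ideal.mem_span_singleton']
  simp [mul_comm]

theorem rTensor_mulLeft_apply {A B : Type*} [CommRing A] [CommRing B] [Algebra A B] (b : B)
    (N : Type*) [AddCommGroup N] [Module A N] (y : B ⊗[A] N) :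
    (LinearMap.mulLeft A b).rTensor N y = b • y := by
  induction y with
  | zero => simp
  | add _ _ h₁ h₂ => rw [smul_add, map_add, h₁, h₂]
  | tmul c z => simp [smul_tmul']

/-- The kernel of `B ⊗ N → B ⧸ (b) ⊗ N` consists of multiples of `b`. -/
theorem exists_smul_eq_of_rTensor_mkₐ_eq_zero {A B : Type*} [CommRing A] [CommRing B]
    [Algebra A B] (b : B) (N : Type*) [AddCommGroup N] [Module A N] (x : B ⊗[A] N)
    (hx : (Ideal.Quotient.mkₐ A (Ideal.span {b})).toLinearMap.rTensor N x = 0) :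
    ∃ y, b • y = x := by
  obtain ⟨y, rfl⟩ := (_root_.rTensor_exact N (exact_mulLeft_mkₐ b)
    (Ideal.Quotient.mkₐ_surjective A _) x).mp hx
  exact ⟨y, (rTensor_mulLeft_apply b N y).symm⟩


theorem lTensor_subtype_smul_apply {A B : Type*} [CommRing A] [CommRing B] [Algebra A B]
    (I : Ideal A) (b : B) (x : B ⊗[A] I) :
    I.subtype.lTensor B (b • x) = b • I.subtype.lTensor B x :=
  (AlgebraTensorModule.lTensor B B I.subtype).map_smul b x

/-- If `b` is a regular element of the maximal ideal of `B` and `B ⧸ (b)` is flat, so is `B`. -/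
theorem Module.Flat.of_quotient_span_singleton {A B : Type*} [CommRing A] [CommRing B]
    [IsNoetherianRing A] [IsNoetherianRing B] [IsLocalRing B] [Algebra A B] {b : B}
    (hb : b ∈ maximalIdeal B) (hreg : IsSMulRegular B b)
    [Module.Flat A (B ⧸ Ideal.span {b})] : Module.Flat A B := by
  refine Module.Flat.iff_lTensor_injective'.mpr fun I ↦ ?_
  let f : B ⊗[A] I →ₗ[B] B ⊗[A] A := AlgebraTensorModule.lTensor B B I.subtype
  have hle : LinearMap.ker f ≤ Ideal.span {b} • LinearMap.ker f := by
    intro x hx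
    have hx' : I.subtype.lTensor B x = 0 := hx
    obtain ⟨y, rfl⟩ := exists_smul_eq_of_rTensor_mkₐ_eq_zero b I x <| by
      apply Module.Flat.lTensor_preserves_injective_linearMap (M := B ⧸ Ideal.span {b})
        I.subtype I.subtype_injective
      rw [← LinearMap.comp_apply, LinearMap.lTensor_comp_rTensor, ← LinearMap.rTensor_comp_lTensor,
        LinearMap.comp_apply, hx', map_zero, map_zero]
    refine Submodule.smul_mem_smul (Ideal.mem_span_singleton_self b) ?_
    have hreg' : IsSMulRegular (B ⊗[A] A) b :=
      ((AlgebraTensorModule.rid A B B).isSMulRegular_congr b).mpr hreg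
    exact hreg'.right_eq_zero_of_smul ((map_smul f b y).symm.trans hx)
  have : IsNoetherian B (B ⊗[A] I) := isNoetherian_of_isNoetherianRing_of_finite B _
  have hker : LinearMap.ker f = ⊥ := Submodule.eq_bot_of_le_smul_of_le_jacobson_bot _ _
    (IsNoetherian.noetherian _) hle
    (((Ideal.span_singleton_le_iff_mem _).mpr hb).trans (maximalIdeal_le_jacobson _))
  have hf : Function.Injective f := LinearMap.ker_eq_bot.mp hker
  exact hf

theorem mem_map_iff_exists_lTensor_subtype_eq {A B : Type*} [CommRing A] [CommRing B]
    [Algebra A B] {I : Ideal A} {c : B} :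
    c ∈ I.map (algebraMap A B) ↔ ∃ y : B ⊗[A] I, I.subtype.lTensor B y = c ⊗ₜ 1 := by
  constructor
  · intro hc
    induction hc using Submodule.span_induction with
    | mem x hx =>
      obtain ⟨i, hi, rfl⟩ := hx
      exact ⟨1 ⊗ₜ ⟨i, hi⟩, by simp [Algebra.algebraMap_eq_smul_one, smul_tmul]⟩
    | zero => exact ⟨0, by simp⟩
    | add x y _ _ hx hy =>
      obtain ⟨⟨x', hx⟩, ⟨y', hy⟩⟩ := And.intro hx hy
      exact ⟨x' + y', by rw [map_add, hx, hy, add_tmul]⟩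
    | smul r x _ hx =>
      obtain ⟨y, hy⟩ := hx
      exact ⟨r • y, by rw [lTensor_subtype_smul_apply, hy, smul_tmul']⟩
  · rintro ⟨y, hy⟩
    suffices h : AlgebraTensorModule.rid A B B (I.subtype.lTensor B y) ∈ I.map (algebraMap A B) by
      simpa [hy] using h
    clear hy
    induction y with
    | zero => simp
    | add x y hx hy => simpa using add_mem hx hy
    | tmul d i =>
      simpa [Algebra.smul_def] using Ideal.mul_mem_right d _ (Ideal.mem_map_of_mem _ i.2)

/-- If `B` is flat and `b` is regular modulo every extended ideal, then `B ⧸ (b)` is flat. -/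
theorem Module.Flat.quotient_span_singleton {A B : Type*} [CommRing A] [CommRing B]
    [Algebra A B] [Module.Flat A B] {b : B}
    (hb : ∀ (I : Ideal A) (c : B), b * c ∈ I.map (algebraMap A B) → c ∈ I.map (algebraMap A B)) :
    Module.Flat A (B ⧸ Ideal.span {b}) := by
  refine Module.Flat.iff_lTensor_injective'.mpr fun I ↦
    (injective_iff_map_eq_zero _).mpr fun z hz ↦ ?_
  have hB := Module.Flat.lTensor_preserves_injective_linearMap (M := B) I.subtype
    I.subtype_injective
  obtain ⟨x, rfl⟩ := LinearMap.rTensor_surjective I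
    (g := (Ideal.Quotient.mkₐ A (Ideal.span {b})).toLinearMap) (Ideal.Quotient.mkₐ_surjective A _) z
  rw [← LinearMap.comp_apply, LinearMap.lTensor_comp_rTensor, ← LinearMap.rTensor_comp_lTensor,
    LinearMap.comp_apply] at hz
  obtain ⟨w, hw⟩ := exists_smul_eq_of_rTensor_mkₐ_eq_zero b A _ hz
  obtain ⟨c, rfl⟩ := (AlgebraTensorModule.rid A B B).symm.surjective w
  obtain ⟨y, hy⟩ := mem_map_iff_exists_lTensor_subtype_eq.mp <| hb I c <|
    mem_map_iff_exists_lTensor_subtype_eq.mpr ⟨x, by simpa [smul_tmul'] using hw.symm⟩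
  have hxy : x = b • y := hB <| by
    rw [lTensor_subtype_smul_apply, hy, ← hw]
    simp
  rw [hxy, ← rTensor_mulLeft_apply]
  exact (_root_.rTensor_exact I (exact_mulLeft_mkₐ b)
    (Ideal.Quotient.mkₐ_surjective A _)).apply_apply_eq_zero y

theorem one_tmul_mem_nonZeroDivisors_iff {A B C : Type*} [CommRing A] [CommRing B] [CommRing C]
    [Algebra A B] [Algebra A C] {b : B} :
    (1 : C) ⊗ₜ[A] b ∈ nonZeroDivisors (C ⊗[A] B) ↔ IsSMulRegular (B ⊗[A] C) b := by
  have hmul (y : C ⊗[A] B) :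
      TensorProduct.comm A C B (y * (1 ⊗ₜ[A] b)) = b • TensorProduct.comm A C B y := by
    induction y with
    | zero => simp
    | add _ _ h₁ h₂ => rw [add_mul, map_add, h₁, h₂, map_add, smul_add]
    | tmul c z => simp [smul_tmul', mul_comm]
  rw [mem_nonZeroDivisors_iff_right, isSMulRegular_iff_right_eq_zero_of_smul,
    (TensorProduct.comm A C B).surjective.forall]
  simp [← hmul]

end

/-- **Proposition (EGA 0_IV 15.1.16).** Let `A → B` be a local homomorphism of noetherian
local rings, `κ` the residue field of `A`, `b` an element of the maximal ideal of `B` and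
`b̄ ∈ B ⊗_A κ` the residue class of `b`.  Then the following are equivalent:
(1) `B/bB` is flat over `A` and `b` is a non-zero-divisor of `B`;
(2) `B` is flat over `A` and `b̄` is a non-zero-divisor of `B ⊗_A κ`. -/
theorem flat_and_nonZeroDivisor_quotient_iff_flat_and_nonZeroDivisor_tensor_residueField
    {A B : Type*} [CommRing A] [CommRing B] [IsNoetherianRing A] [IsNoetherianRing B]
    [IsLocalRing A] [IsLocalRing B] [Algebra A B] (hloc : IsLocalHom (algebraMap A B))
    (b : B) (hb : b ∈ IsLocalRing.maximalIdeal B) :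
    (Module.Flat A (B ⧸ Ideal.span {b}) ∧ b ∈ nonZeroDivisors B) ↔
      (Module.Flat A B ∧
        (1 : IsLocalRing.ResidueField A) ⊗ₜ[A] b ∈
          nonZeroDivisors (TensorProduct A (IsLocalRing.ResidueField A) B)) := by
  have hB : b ∈ nonZeroDivisors B ↔ IsSMulRegular B b := by
    rw [mem_nonZeroDivisors_iff_right, isSMulRegular_iff_right_eq_zero_of_smul]
    simp [mul_comm]
  rw [hB, one_tmul_mem_nonZeroDivisors_iff]
  constructor
  · rintro ⟨_, hreg⟩
    refine ⟨.of_quotient_span_singleton hb hreg, fun x y hxy ↦ ?_⟩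
    apply (LinearMap.lTensor_inj_iff_rTensor_inj _ _).mp
      (LinearMap.lTensor_injective_of_exact_of_flat _ (Ideal.Quotient.mkₐ_surjective A _)
        (LinearMap.mulLeft A b) hreg (exact_mulLeft_mkₐ b) (IsLocalRing.ResidueField A))
    simpa only [rTensor_mulLeft_apply] using hxy
  · rintro ⟨_, hreg⟩
    refine ⟨.quotient_span_singleton fun I c ↦ mem_map_of_mul_mem_map_of_flat hreg I, ?_⟩
    refine .of_right_eq_zero_of_smul fun c hc ↦ ?_
    simpa using mem_map_of_mul_mem_map_of_flat hreg ⊥ (c := c) (by simpa using hc)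
end

section
/- Let S and D be schemes, f : D → S a separated morphism which is locally of finite type, x a point of D and s = f(x). Assume that x is an isolated point of the fiber f⁻¹(s). Then there exist an étale morphism S' → S, a point x' of D' = D ×_S S' lying above x, and an open and closed subset V' of D' containing x', such that V' (with its open subscheme structure) is finite over S' and f'⁻¹(f'(x')) ∩ V' = {x'}, where f' : D' → S' denotes the base change of f. -/
open AlgebraicGeometry CategoryTheory CategoryTheory.Limits

section QuasiFinite

open TensorProduct

universe u

/-- Let `f : X ⟶ S` be separated, given on affine open charts `Spec A` of `X` and `Spec R` of `S`
by a finite type algebra `R → A` which is quasi-finite at a prime `q`. After an étale base change,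
`f` becomes finite on an open and closed neighbourhood of a point `x'` above `q` which meets the
fiber through `x'` only in `x'`. -/
theorem exists_etale_isClosed_isFinite_of_chart {X S : Scheme.{u}} (f : X ⟶ S) [IsSeparated f]
    {R A : Type u} [CommRing R] [CommRing A] [Algebra R A] [Algebra.FiniteType R A]
    (j : Spec (.of A) ⟶ X) (i : Spec (.of R) ⟶ S) [IsOpenImmersion j] [IsOpenImmersion i]
    (hji : Spec.map (CommRingCat.ofHom (algebraMap R A)) ≫ i = j ≫ f)
    (q : PrimeSpectrum A) [Algebra.QuasiFiniteAt R q.asIdeal] :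
    ∃ (S' : Scheme.{u}) (g : S' ⟶ S) (_ : Etale g) (x' : (pullback f g : Scheme))
      (V : (pullback f g).Opens), pullback.fst f g x' = j q ∧
      IsClosed (V : Set (pullback f g : Scheme)) ∧ x' ∈ V ∧
      IsFinite (V.ι ≫ pullback.snd f g) ∧
      pullback.snd f g ⁻¹' {pullback.snd f g x'} ∩ V = {x'} := by
  obtain ⟨R', _, _, _, P, _, _, e, _, P', _, _, hP', heP', -, _, huniq⟩ :=
    Algebra.exists_etale_isIdempotentElem_forall_liesOver_eq (q.asIdeal.under R) q.asIdeal
  let φ : Spec (.of R') ⟶ Spec (.of R) := Spec.map (CommRingCat.ofHom (algebraMap R R'))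
  have : Etale φ := HasRingHomProperty.Spec_iff.mpr (RingHom.etale_algebraMap.mpr ‹_›)
  let p₁ : Spec (.of (R' ⊗[R] A)) ⟶ Spec (.of A) :=
    Spec.map (CommRingCat.ofHom Algebra.TensorProduct.includeRight.toRingHom)
  let p₂ : Spec (.of (R' ⊗[R] A)) ⟶ Spec (.of R') :=
    Spec.map (CommRingCat.ofHom (algebraMap R' (R' ⊗[R] A)))
  let e₁ : Spec (.of (R' ⊗[R] A)) ≅
      pullback (Spec.map (CommRingCat.ofHom (algebraMap R A))) φ :=
    (pullbackSpecIso R R' A).symm ≪≫ pullbackSymmetry _ _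
  have he₁ : e₁.hom ≫ pullback.fst _ _ = p₁ := by
    simp only [e₁, Iso.trans_hom, Iso.symm_hom, Category.assoc, φ, pullbackSymmetry_hom_comp_fst]
    exact pullbackSpecIso_inv_snd ..
  have he₂ : e₁.hom ≫ pullback.snd _ _ = p₂ := by
    simp only [e₁, Iso.trans_hom, Iso.symm_hom, Category.assoc, φ, pullbackSymmetry_hom_comp_snd]
    exact pullbackSpecIso_inv_fst ..
  let m : pullback (Spec.map (CommRingCat.ofHom (algebraMap R A))) φ ⟶ pullback f (φ ≫ i) :=
    pullback.map _ _ _ _ j (𝟙 _) i hji (by simp)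
  let g : Spec (.of (R' ⊗[R] A)) ⟶ pullback f (φ ≫ i) := e₁.hom ≫ m
  have hfst : g ≫ pullback.fst f (φ ≫ i) = p₁ ≫ j := by
    have : m ≫ pullback.fst f (φ ≫ i) = pullback.fst _ _ ≫ j := pullback.lift_fst ..
    rw [Category.assoc, this, reassoc_of% he₁]
  have hsnd : g ≫ pullback.snd f (φ ≫ i) = p₂ := by
    have : m ≫ pullback.snd f (φ ≫ i) = pullback.snd _ _ ≫ 𝟙 _ := pullback.lift_snd ..
    rw [Category.assoc, this, Category.comp_id, he₂]
  let W := g ''ᵁ PrimeSpectrum.basicOpen e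
  have : IsFinite (W.ι ≫ pullback.snd f _) := by
    let ι : Spec (.of (Localization.Away e)) ⟶ pullback f (φ ≫ i) :=
      Spec.map (CommRingCat.ofHom <| algebraMap _ _) ≫ g
    have hιW : ι.opensRange = W := by
      simp only [Scheme.Hom.opensRange_comp, ι, W]
      congr 1
      exact TopologicalSpace.Opens.ext <| PrimeSpectrum.localization_away_comap_range _ _
    have hι : ι ≫ pullback.snd f (φ ≫ i) =
        Spec.map (CommRingCat.ofHom (algebraMap R' (Localization.Away e))) := by
      simp only [ι, Category.assoc, hsnd, p₂, ← Spec.map_comp, ← CommRingCat.ofHom_comp,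
        ← IsScalarTower.algebraMap_eq]
    have : IsFinite (ι ≫ pullback.snd f (φ ≫ i)) := by
      rw [hι, IsFinite.SpecMap_iff]
      exact RingHom.finite_algebraMap.mpr ‹_›
    have hW : ι.opensRange.ι ≫ pullback.snd f (φ ≫ i) =
        (Scheme.Hom.isoOpensRange ι).inv ≫ ι ≫ pullback.snd f (φ ≫ i) := by
      simp
    rw [← hιW, hW]
    infer_instance
  have : IsFinite W.ι := .of_comp _ (pullback.snd f _)
  have hclosed : IsClosed (W : Set (pullback f (φ ≫ i) : Scheme)) := by
    simpa using W.ι.isClosedMap.isClosed_range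
  refine ⟨Spec (.of R'), φ ≫ i, inferInstance, g ⟨P', ‹_›⟩, W, ?_, hclosed,
    ⟨⟨P', ‹_›⟩, heP', rfl⟩, ‹_›, ?_⟩
  · trans (g ≫ pullback.fst f (φ ≫ i)) ⟨P', ‹_›⟩
    · rfl
    rw [hfst]
    exact congr(j $(PrimeSpectrum.ext hP'))
  · refine Set.Subset.antisymm ?_ (Set.singleton_subset_iff.mpr ⟨rfl, ⟨P', ‹_›⟩, heP', rfl⟩)
    rintro _ ⟨hz, z, hez, rfl⟩
    replace hz : (g ≫ pullback.snd f (φ ≫ i)) z = (g ≫ pullback.snd f (φ ≫ i)) ⟨P', ‹_›⟩ := hz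
    rw [hsnd] at hz
    have hzP : z.asIdeal.under R' = P'.under R' := congr(($hz).asIdeal)
    have : z.asIdeal.LiesOver P := ⟨(Ideal.over_def P' P).trans hzP.symm⟩
    exact congr(g $(PrimeSpectrum.ext (huniq z.asIdeal z.2 this hez)))

/-- A separated morphism locally of finite type which is quasi-finite at `x` becomes, after an
étale base change, finite on an open and closed neighbourhood of a point `x'` above `x`
which meets the fiber through `x'` only in `x'`. -/
theorem exists_etale_isClosed_isFinite_of_quasiFiniteAt {X S : Scheme.{u}} (f : X ⟶ S)
    [LocallyOfFiniteType f] [IsSeparated f] {x : X} (hx : f.QuasiFiniteAt x) :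
    ∃ (S' : Scheme.{u}) (g : S' ⟶ S) (_ : Etale g) (x' : (pullback f g : Scheme))
      (V : (pullback f g).Opens), pullback.fst f g x' = x ∧
      IsClosed (V : Set (pullback f g : Scheme)) ∧ x' ∈ V ∧
      IsFinite (V.ι ≫ pullback.snd f g) ∧
      pullback.snd f g ⁻¹' {pullback.snd f g x'} ∩ V = {x'} := by
  obtain ⟨_, ⟨U, hU, rfl⟩, hxU, -⟩ := S.isBasis_affineOpens.exists_subset_of_mem_open
    (Set.mem_univ (f x)) isOpen_univ
  obtain ⟨_, ⟨V, hV, rfl⟩, hxV, hUV : V ≤ f ⁻¹ᵁ U⟩ :=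
    X.isBasis_affineOpens.exists_subset_of_mem_open hxU (f ⁻¹ᵁ U).2
  replace hU : IsAffineOpen U := hU
  replace hV : IsAffineOpen V := hV
  have : (f.appLE U V hUV).hom.FiniteType := f.finiteType_appLE hU hV hUV
  algebraize [(f.appLE U V hUV).hom]
  have : Algebra.QuasiFiniteAt Γ(S, U) (hV.primeIdealOf ⟨x, hxV⟩).asIdeal :=
    hx.quasiFiniteAt hV hU hUV hxV
  have key := exists_etale_isClosed_isFinite_of_chart f (R := Γ(S, U)) (A := Γ(X, V))
    hV.fromSpec hU.fromSpec (IsAffineOpen.SpecMap_appLE_fromSpec f hU hV hUV)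
    (hV.primeIdealOf ⟨x, hxV⟩)
  have hxx : hV.fromSpec (hV.primeIdealOf ⟨x, hxV⟩) = x := hV.fromSpec_primeIdealOf ⟨x, hxV⟩
  rwa [hxx] at key

end QuasiFinite

/-- **Proposition (EGA IV 18.12.1).** Let `f : D → S` be a separated morphism locally of
finite type, `x` a point of `D` and `s = f(x)`.  Assume that `x` is an isolated point of the
fiber `f⁻¹(s)`.  Then there exist an étale morphism `g : S' → S`, a point `x'` of
`D' = D ×_S S'` above `x` and an open and closed subset `V'` of `D'` containing `x'` such
that `V'` is finite over `S'` and `f'⁻¹(f'(x')) ∩ V' = {x'}`, where `f' : D' → S'` is the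
base change of `f`. -/
theorem exists_etale_clopen_finite_of_isolated_in_fiber
    {D S : Scheme} (f : D ⟶ S) [IsSeparated f] [LocallyOfFiniteType f] (x : D)
    (hx : ∃ U : Set D, IsOpen U ∧ U ∩ f.base ⁻¹' {f.base x} = {x}) :
    ∃ (S' : Scheme) (g : S' ⟶ S) (_ : IsEtale g)
      (x' : (pullback f g : Scheme)) (V' : (pullback f g : Scheme).Opens),
      (pullback.fst f g).base x' = x ∧
      IsClosed (V' : Set (pullback f g : Scheme)) ∧ x' ∈ V' ∧
      IsFinite (V'.ι ≫ pullback.snd f g) ∧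
      (pullback.snd f g).base ⁻¹' {(pullback.snd f g).base x'} ∩ ↑V' = {x'} := by
  have hqf : f.QuasiFiniteAt x := by
    rw [Scheme.Hom.quasiFiniteAt_iff_isOpen_singleton_asFiber,
      ← (f.fiberHomeo (f x)).isOpen_image]
    obtain ⟨U, hU, hUx⟩ := hx
    refine ⟨U, hU, ?_⟩
    ext y
    simp only [Set.image_singleton, Scheme.Hom.asFiber, Homeomorph.apply_symm_apply,
      Set.mem_preimage, Set.mem_singleton_iff, Subtype.ext_iff]
    have hy := Set.ext_iff.mp hUx y.1
    exact ⟨fun h ↦ hy.mp ⟨h, y.2⟩, fun h ↦ (hy.mpr h).1⟩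
  exact exists_etale_isClosed_isFinite_of_quasiFiniteAt f hqf
end

section
/- Let S be an irreducible Noetherian scheme, g : D → S a morphism of finite type, and {D_i}_{i∈I} the set of irreducible components of D (each with its reduced closed subscheme structure). Assume that, for each i ∈ I, the restriction g|_{D_i} : D_i → S is surjective. Then there exists a dense open subset V ⊆ S such that, for every point v ∈ V and any two distinct indices i, j ∈ I, the fibers D_{i,v} and D_{j,v} have no common irreducible component. -/
open AlgebraicGeometry CategoryTheory

/-- A subset `C` is an irreducible component of the subspace `A`: it is a maximal element
among irreducible subsets of `A`. -/
def IsIrreducibleComponentOf {X : Type*} [TopologicalSpace X] (C A : Set X) : Prop :=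
  Maximal (fun T => T ⊆ A ∧ IsIrreducible T) C

open TensorProduct

universe u

section InjectiveRTensor

variable {A K F : Type*} [CommRing A] [AddCommGroup K] [Module A K] [AddCommGroup F] [Module A F]
  {ι : K →ₗ[A] F} {M M' M'' : Type*} [AddCommGroup M] [Module A M]
  [AddCommGroup M'] [Module A M'] [AddCommGroup M''] [Module A M'']

lemma LinearMap.rTensor_injective_of_exact [Module.Flat A F] {f : M' →ₗ[A] M} {g : M →ₗ[A] M''}
    (hf : Function.Injective f) (hg : Function.Surjective g) (hfg : Function.Exact f g)
    (h' : Function.Injective (ι.rTensor M')) (h'' : Function.Injective (ι.rTensor M'')) :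
    Function.Injective (ι.rTensor M) := by
  rw [injective_iff_map_eq_zero]
  intro x hx
  have hgx : g.lTensor K x = 0 := by
    apply h''
    rw [map_zero, ← LinearMap.comp_apply, LinearMap.rTensor_comp_lTensor,
      ← LinearMap.lTensor_comp_rTensor, LinearMap.comp_apply, hx, map_zero]
  obtain ⟨y, rfl⟩ := (lTensor_exact K hfg hg x).mp hgx
  have hy : f.lTensor F (ι.rTensor M' y) = 0 := by
    rw [← LinearMap.comp_apply, LinearMap.lTensor_comp_rTensor,
      ← LinearMap.rTensor_comp_lTensor, LinearMap.comp_apply, hx]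
  have := (injective_iff_map_eq_zero _).mp (Module.Flat.lTensor_preserves_injective_linearMap
    (M := F) f hf) _ hy
  rw [(injective_iff_map_eq_zero _).mp h' _ this, map_zero]

lemma LinearMap.rTensor_injective_of_linearEquiv (e : M' ≃ₗ[A] M)
    (h : Function.Injective (ι.rTensor M')) : Function.Injective (ι.rTensor M) := by
  have : ι.rTensor M = e.toLinearMap.lTensor F ∘ₗ ι.rTensor M' ∘ₗ e.symm.toLinearMap.lTensor K := by
    ext; simp
  rw [this]
  exact (LinearEquiv.lTensor F e).injective.comp (h.comp (LinearEquiv.lTensor K e.symm).injective)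

lemma LinearMap.rTensor_injective_of_monotone_of_iSup_eq_top [Module.Flat A F] {B : Type*}
    [CommRing B] [Algebra A B] [Module B M] [IsScalarTower A B M]
    (N : ℕ →o Submodule B M) (hN : ⨆ n, N n = ⊤)
    (h : ∀ n, Function.Injective (ι.rTensor (N n))) : Function.Injective (ι.rTensor M) := by
  let f (n : ℕ) : N n →ₗ[A] M := (N n).subtype.restrictScalars A
  let g {n m : ℕ} (hnm : n ≤ m) : N n →ₗ[A] N m :=
    (Submodule.inclusion (N.monotone hnm)).restrictScalars A
  have hfg {n m : ℕ} (hnm : n ≤ m) : f m ∘ₗ g hnm = f n := rfl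
  have key (x : K ⊗[A] M) : ∃ n, ∃ y : K ⊗[A] N n, (f n).lTensor K y = x := by
    induction x with
    | zero => exact ⟨0, 0, map_zero _⟩
    | tmul k m =>
      obtain ⟨n, hn⟩ := (Submodule.mem_iSup_of_directed N N.monotone.directed_le).mp
        (hN ▸ Submodule.mem_top : m ∈ ⨆ n, N n)
      exact ⟨n, k ⊗ₜ ⟨m, hn⟩, rfl⟩
    | add x y hx hy =>
      obtain ⟨n, x, rfl⟩ := hx
      obtain ⟨m, y, rfl⟩ := hy
      have hn := le_max_left n m
      have hm := le_max_right n m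
      refine ⟨max n m, (g hn).lTensor K x + (g hm).lTensor K y, ?_⟩
      rw [map_add, ← LinearMap.comp_apply, ← LinearMap.comp_apply, ← LinearMap.lTensor_comp,
        ← LinearMap.lTensor_comp, hfg hn, hfg hm]
  rw [injective_iff_map_eq_zero]
  intro x hx
  obtain ⟨n, y, rfl⟩ := key x
  have hy : (f n).lTensor F (ι.rTensor (N n) y) = 0 := by
    rw [← LinearMap.comp_apply, LinearMap.lTensor_comp_rTensor,
      ← LinearMap.rTensor_comp_lTensor, LinearMap.comp_apply, hx]
  have := (injective_iff_map_eq_zero _).mp (Module.Flat.lTensor_preserves_injective_linearMap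
    (M := F) (f n) (N n).injective_subtype) _ hy
  rw [(injective_iff_map_eq_zero _).mp (h n) _ this, map_zero]

lemma LinearMap.rTensor_injective_of_submodule_le [Module.Flat A F] {B : Type*} [CommRing B]
    [Algebra A B] [Module B M] [IsScalarTower A B M] {P Q : Submodule B M} (hPQ : P ≤ Q)
    (hP : Function.Injective (ι.rTensor P))
    (hQ : Function.Injective (ι.rTensor (Q ⧸ P.submoduleOf Q))) :
    Function.Injective (ι.rTensor Q) := by
  let f : P →ₗ[A] Q := (Submodule.inclusion hPQ).restrictScalars A
  let g : Q →ₗ[A] Q ⧸ P.submoduleOf Q := (P.submoduleOf Q).mkQ.restrictScalars A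
  have hf : Function.Injective f := Submodule.inclusion_injective hPQ
  have hg : Function.Surjective g := Submodule.mkQ_surjective (P.submoduleOf Q)
  refine LinearMap.rTensor_injective_of_exact hf hg (fun y ↦ ?_) hP hQ
  have hgy : g y = 0 ↔ y.1 ∈ P := Submodule.Quotient.mk_eq_zero (P.submoduleOf Q)
  rw [hgy]
  exact ⟨fun h ↦ ⟨⟨y, h⟩, rfl⟩, fun ⟨z, hz⟩ ↦ hz ▸ z.2⟩

lemma LinearMap.lTensor_injective_of_rTensor_injective [Module.Flat A F]
    {N : Type*} [AddCommGroup N] [Module A N] {π : F →ₗ[A] N} (hπ : Function.Surjective π)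
    (hιπ : Function.Exact ι π) {f : M' →ₗ[A] M} {g : M →ₗ[A] M''}
    (hf : Function.Injective f) (hg : Function.Surjective g) (hfg : Function.Exact f g)
    (h'' : Function.Injective (ι.rTensor M'')) :
    Function.Injective (f.lTensor N) := by
  rw [injective_iff_map_eq_zero]
  intro x hx
  obtain ⟨x, rfl⟩ := LinearMap.rTensor_surjective M' hπ x
  rw [← LinearMap.comp_apply, LinearMap.lTensor_comp_rTensor,
    ← LinearMap.rTensor_comp_lTensor, LinearMap.comp_apply] at hx
  obtain ⟨k, hk⟩ := (rTensor_exact M hιπ hπ _).mp hx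
  have hgk : g.lTensor K k = 0 := by
    apply h''
    rw [map_zero, ← LinearMap.comp_apply, LinearMap.rTensor_comp_lTensor,
      ← LinearMap.lTensor_comp_rTensor, LinearMap.comp_apply, hk, ← LinearMap.comp_apply,
      ← LinearMap.lTensor_comp, hfg.linearMap_comp_eq_zero]
    simp
  obtain ⟨k, rfl⟩ := (lTensor_exact K hfg hg _).mp hgk
  have : x = ι.rTensor M' k := by
    apply Module.Flat.lTensor_preserves_injective_linearMap (M := F) f hf
    rw [← hk, ← LinearMap.comp_apply, ← LinearMap.comp_apply, LinearMap.lTensor_comp_rTensor,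
      LinearMap.rTensor_comp_lTensor]
  rw [this]
  exact (rTensor_exact M' hιπ hπ _).mpr ⟨k, rfl⟩

end InjectiveRTensor

section Generic

variable (A : Type u) [CommRing A]

/-- `Tor₁ᴬ(M, κ(p))` vanishes, expressed through the flat presentation
`0 → pAₚ → Aₚ → κ(p) → 0`. -/
def TorResidueFieldVanishes (p : Ideal A) [p.IsPrime] (M : Type*) [AddCommGroup M] [Module A M] :
    Prop :=
  Function.Injective (((IsLocalRing.maximalIdeal (Localization.AtPrime p)).subtype.restrictScalars
    A).rTensor M)

/-- `Tor₁ᴬ(M, κ(p))` vanishes for all `p` in a nonempty basic open subset of `Spec A`. -/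
def GenericallyTorVanishes (M : Type*) [AddCommGroup M] [Module A M] : Prop :=
  ∃ a : A, a ≠ 0 ∧ ∀ (p : Ideal A) [p.IsPrime], a ∉ p → TorResidueFieldVanishes A p M

/-- Every finite `B`-module satisfies `GenericallyTorVanishes A`. -/
def FiniteModulesGenericallyTorVanish (A B : Type u) [CommRing A] [CommRing B] [Algebra A B] :
    Prop :=
  ∀ (M : Type u) [AddCommGroup M] [Module A M] [Module B M] [IsScalarTower A B M]
    [Module.Finite B M], GenericallyTorVanishes A M

variable {A}

lemma GenericallyTorVanishes.of_finite [IsDomain A] [IsNoetherianRing A] (M : Type*)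
    [AddCommGroup M] [Module A M] [Module.Finite A M] : GenericallyTorVanishes A M := by
  induction ‹Module.Finite A M› using
    IsNoetherianRing.induction_on_isQuotientEquivQuotientPrime A with
  | subsingleton N =>
    exact ⟨1, one_ne_zero, fun p _ _ ↦ Function.injective_of_subsingleton _⟩
  | quotient N q e =>
    by_cases hq : q.1 = ⊥
    · have : Module.Flat A N := .of_linearEquiv (e.trans (Submodule.quotEquivOfEqBot _ hq))
      exact ⟨1, one_ne_zero, fun p _ _ ↦ Module.Flat.rTensor_preserves_injective_linearMap _
        Subtype.val_injective⟩
    · obtain ⟨a, haq, ha⟩ := Submodule.exists_mem_ne_zero_of_ne_bot hq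
      refine ⟨a, ha, fun p _ hap ↦ ?_⟩
      have hN (n : N) : a • n = 0 := by
        apply e.injective
        obtain ⟨b, hb⟩ := Ideal.Quotient.mk_surjective (e n)
        rw [map_smul, map_zero, ← hb, Algebra.smul_def, Ideal.Quotient.algebraMap_eq, ← map_mul,
          Ideal.Quotient.eq_zero_iff_mem]
        exact Ideal.mul_mem_right _ _ haq
      have : Subsingleton (IsLocalRing.maximalIdeal (Localization.AtPrime p) ⊗[A] N) := by
        refine subsingleton_of_forall_eq 0 fun x ↦ ?_
        induction x with
        | zero => rfl
        | add x y hx hy => rw [hx, hy, add_zero]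
        | tmul k n =>
          have hu := IsLocalization.map_units (Localization.AtPrime p) (⟨a, hap⟩ : p.primeCompl)
          have : k = a • (hu.unit⁻¹.1 • k) := by
            rw [← IsScalarTower.algebraMap_smul (Localization.AtPrime p) a, smul_smul]
            simp
          rw [this, TensorProduct.smul_tmul, hN, TensorProduct.tmul_zero]
      exact Function.injective_of_subsingleton _
  | exact N₁ N₂ N₃ f g hf hg hfg h₁ h₃ =>
    obtain ⟨a, ha, h₁⟩ := h₁
    obtain ⟨b, hb, h₃⟩ := h₃
    exact ⟨a * b, mul_ne_zero ha hb, fun p _ hp ↦ LinearMap.rTensor_injective_of_exact hf hg hfg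
      (h₁ p fun h ↦ hp (p.mul_mem_right _ h)) (h₃ p fun h ↦ hp (p.mul_mem_left _ h))⟩

/-- If `M` is exhausted by the images of a finite `B`-module `N` under the powers of an
endomorphism, then `Tor₁` with the residue fields of `A` vanishes generically on `M`. -/
lemma GenericallyTorVanishes.of_endomorphism [IsDomain A] {B : Type u} [CommRing B] [Algebra A B]
    [IsNoetherianRing B]
    (hB : FiniteModulesGenericallyTorVanish A B)
    {M : Type u} [AddCommGroup M] [Module A M] [Module B M] [IsScalarTower A B M]
    (x : M →ₗ[B] M) (N : Submodule B M) [Module.Finite B N]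
    (hN : ⨆ n, N.map (x ^ n) = ⊤) : GenericallyTorVanishes A M := by
  let L (n : ℕ) : Submodule B M := ⨆ i < n, N.map (x ^ i)
  have hL (n : ℕ) : L (n + 1) = L n ⊔ N.map (x ^ n) := by
    simp only [L, Order.lt_add_one_iff]
    exact biSup_le_eq_sup _ n
  have hLmono : Monotone L := monotone_nat_of_le_succ fun n ↦ hL n ▸ le_sup_left
  have hxL (n : ℕ) : (L n).map x ≤ L (n + 1) := by
    simp only [L, Submodule.map_iSup, iSup_le_iff]
    intro i hi
    rw [← Submodule.map_comp, ← Module.End.mul_eq_comp, ← pow_succ']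
    exact le_iSup₂_of_le (i + 1) (by omega) le_rfl
  let k : ℕ →o Submodule B N :=
    ⟨fun n ↦ (L n).comap ((x ^ n) ∘ₗ N.subtype), monotone_nat_of_le_succ fun n y hy ↦ by
      simp only [Submodule.mem_comap] at hy ⊢
      rw [pow_succ']
      exact hxL n (Submodule.mem_map_of_mem hy)⟩
  obtain ⟨n₀, hn₀⟩ := monotone_stabilizes_iff_noetherian.mpr (inferInstance : IsNoetherian B N) k
  choose a ha hak using fun n ↦ hB (N ⧸ k n)
  have hquot (p : Ideal A) [p.IsPrime] (hp : ∏ i ∈ Finset.range (n₀ + 1), a i ∉ p) (n : ℕ) :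
      TorResidueFieldVanishes A p (N ⧸ k n) := by
    have (m : ℕ) (hm : m ≤ n₀) : TorResidueFieldVanishes A p (N ⧸ k m) :=
      hak m p fun h ↦ hp (p.mem_of_dvd (Finset.dvd_prod_of_mem a (by simpa [Nat.lt_succ_iff])) h)
    obtain h | h := le_total n n₀
    · exact this n h
    · rw [← hn₀ n h]
      exact this n₀ le_rfl
  refine ⟨∏ i ∈ Finset.range (n₀ + 1), a i, Finset.prod_ne_zero_iff.mpr fun i _ ↦ ha i,
    fun p _ hp ↦ ?_⟩
  refine LinearMap.rTensor_injective_of_monotone_of_iSup_eq_top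
    ⟨L, hLmono⟩ ?_ fun n ↦ ?_
  · exact top_le_iff.mp (hN ▸ iSup_mono' fun n ↦ ⟨n + 1, le_sup_right.trans (hL n).ge⟩)
  · change Function.Injective (LinearMap.rTensor (L n) _)
    induction n with
    | zero =>
      have : L 0 = ⊥ := by simp [L]
      have : Subsingleton (L 0) := this ▸ inferInstance
      exact Function.injective_of_subsingleton _
    | succ n ih =>
      let φ : N →ₗ[B] L (n + 1) := ((x ^ n) ∘ₗ N.subtype).codRestrict _ fun y ↦
        hL n ▸ le_sup_right (a := L n) (Submodule.mem_map_of_mem y.2)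
      let ψ : N →ₗ[B] L (n + 1) ⧸ (L n).submoduleOf (L (n + 1)) := Submodule.mkQ _ ∘ₗ φ
      have hψ : Function.Surjective ψ := by
        intro z
        obtain ⟨⟨z, hz⟩, rfl⟩ := Submodule.mkQ_surjective _ z
        obtain ⟨l, hl, _, ⟨y, hy, rfl⟩, rfl⟩ := Submodule.mem_sup.mp (hL n ▸ hz)
        refine ⟨⟨y, hy⟩, (Submodule.Quotient.eq _).mpr ?_⟩
        simpa [φ, Submodule.submoduleOf] using hl
      have hker : k n = LinearMap.ker ψ := by
        rw [LinearMap.ker_comp, Submodule.ker_mkQ]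
        rfl
      let e := (Submodule.quotEquivOfEq _ _ hker).trans (ψ.quotKerEquivOfSurjective hψ)
      exact LinearMap.rTensor_injective_of_submodule_le (hLmono n.le_succ) ih
        (LinearMap.rTensor_injective_of_linearEquiv (e.restrictScalars A) (hquot p hp n))

lemma FiniteModulesGenericallyTorVanish.of_surjective {B C : Type u} [CommRing B] [CommRing C]
    [Algebra A B] [Algebra A C] (f : B →ₐ[A] C) (hf : Function.Surjective f)
    (hB : FiniteModulesGenericallyTorVanish A B) : FiniteModulesGenericallyTorVanish A C := by
  intro M _ _ _ _ _
  let : Module B M := Module.compHom M f.toRingHom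
  have hsmul (b : B) (m : M) : b • m = f b • m := rfl
  have : IsScalarTower A B M := ⟨fun a b m ↦ by rw [hsmul, hsmul, map_smul, smul_assoc]⟩
  have : Module.Finite B M := by
    obtain ⟨s, hs⟩ := Module.Finite.fg_top (R := C) (M := M)
    refine ⟨s, eq_top_iff.mpr fun m _ ↦ ?_⟩
    have hm : m ∈ Submodule.span C (s : Set M) := hs ▸ Submodule.mem_top
    induction hm using Submodule.span_induction with
    | mem x h => exact Submodule.subset_span h
    | zero => exact zero_mem _
    | add x y _ _ hx hy => exact add_mem (hx trivial) (hy trivial)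
    | smul c x _ hx =>
      obtain ⟨b, rfl⟩ := hf c
      exact Submodule.smul_mem _ b (hx trivial)
  exact hB M

open Polynomial in
lemma FiniteModulesGenericallyTorVanish.polynomial [IsDomain A] {B : Type u} [CommRing B]
    [Algebra A B] [IsNoetherianRing B] (hB : FiniteModulesGenericallyTorVanish A B) :
    FiniteModulesGenericallyTorVanish A B[X] := by
  intro M _ _ _ _ _
  let : Module B M := Module.compHom M (C : B →+* B[X])
  have hsmul (b : B) (m : M) : b • m = C b • m := rfl
  have : IsScalarTower B B[X] M := ⟨fun b p m ↦ by rw [hsmul, Polynomial.smul_eq_C_mul, mul_smul]⟩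
  have : IsScalarTower A B M := ⟨fun a b m ↦ by
    rw [hsmul, hsmul, ← smul_assoc, Polynomial.smul_C]⟩
  obtain ⟨s, hs⟩ := Module.Finite.fg_top (R := B[X]) (M := M)
  have : Module.Finite B (Submodule.span B (s : Set M)) :=
    Module.Finite.span_of_finite B s.finite_toSet
  refine .of_endomorphism hB (Algebra.lsmul B B M (X : B[X])) (Submodule.span B (s : Set M)) ?_
  have hX : Submodule.span B (Set.range fun n : ℕ ↦ (X ^ n : B[X])) = ⊤ := by
    have := (Polynomial.basisMonomials B).span_eq
    simpa [Polynomial.coe_basisMonomials, Polynomial.X_pow_eq_monomial] using this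
  have := Submodule.span_smul_of_span_eq_top hX (s : Set M)
  rw [hs, Submodule.restrictScalars_top] at this
  rw [eq_top_iff, ← this, Submodule.span_le]
  rintro _ ⟨_, ⟨n, rfl⟩, m, hm, rfl⟩
  refine Submodule.mem_iSup_of_mem n ⟨m, Submodule.subset_span hm, ?_⟩
  simp [← map_pow]

/-- Finite modules over a finite type algebra over a noetherian domain have generically vanishing
`Tor₁` with the residue fields of the base. -/
theorem FiniteModulesGenericallyTorVanish.of_finiteType [IsDomain A] [IsNoetherianRing A]
    (B : Type u) [CommRing B] [Algebra A B] [Algebra.FiniteType A B] :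
    FiniteModulesGenericallyTorVanish A B := by
  obtain ⟨n, f, hf⟩ := Algebra.FiniteType.iff_quotient_mvPolynomial''.mp ‹Algebra.FiniteType A B›
  refine .of_surjective f hf ?_
  clear f hf
  induction n with
  | zero =>
    intro M _ _ _ _ _
    have : Module.Finite A (MvPolynomial (Fin 0) A) :=
      .equiv (MvPolynomial.isEmptyAlgEquiv A (Fin 0)).symm.toLinearEquiv
    have : Module.Finite A M := .trans (MvPolynomial (Fin 0) A) M
    exact .of_finite M
  | succ n ih =>
    exact .of_surjective (B := Polynomial (MvPolynomial (Fin n) A))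
      (MvPolynomial.finSuccEquiv A n).symm.toAlgHom
      (MvPolynomial.finSuccEquiv A n).symm.surjective ih.polynomial

end Generic

/-- Generically on the base, the vanishing locus of a nonzerodivisor contains no irreducible
component of the fiber. -/
lemma Algebra.FiniteType.exists_prime_le_notMem_comap_eq {A B : Type u} [CommRing A]
    [CommRing B] [Algebra A B] [IsDomain A] [IsNoetherianRing A] [Algebra.FiniteType A B] {f : B}
    (hf : f ∈ nonZeroDivisors B) :
    ∃ a : A, a ≠ 0 ∧ ∀ q : PrimeSpectrum B, algebraMap A B a ∉ q.asIdeal →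
      ∃ q' ≤ q, f ∉ q'.asIdeal ∧
        PrimeSpectrum.comap (algebraMap A B) q' = PrimeSpectrum.comap (algebraMap A B) q := by
  obtain ⟨a, ha, H⟩ := FiniteModulesGenericallyTorVanish.of_finiteType (A := A) B
    (B ⧸ Ideal.span {f})
  refine ⟨a, ha, fun q hq ↦ ?_⟩
  set p := PrimeSpectrum.comap (algebraMap A B) q with hp
  have hinj : Function.Injective
      ((LinearMap.mulLeft A f).lTensor p.asIdeal.ResidueField) := by
    refine LinearMap.lTensor_injective_of_rTensor_injective
      (π := Algebra.linearMap (Localization.AtPrime p.asIdeal) p.asIdeal.ResidueField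
        |>.restrictScalars A)
      (ι := ((IsLocalRing.maximalIdeal (Localization.AtPrime p.asIdeal)).subtype.restrictScalars A))
      (g := (Ideal.Quotient.mkₐ A (Ideal.span {f})).toLinearMap)
      IsLocalRing.residue_surjective ?_ ?_ Ideal.Quotient.mk_surjective ?_ (H p.asIdeal hq)
    · intro x
      change IsLocalRing.residue _ x = 0 ↔ _
      rw [IsLocalRing.residue_eq_zero_iff]
      exact ⟨fun h ↦ ⟨⟨x, h⟩, rfl⟩, fun ⟨y, hy⟩ ↦ hy ▸ y.2⟩
    · intro x y hxy
      exact (mul_cancel_left_mem_nonZeroDivisors hf).mp hxy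
    · intro x
      change Ideal.Quotient.mk _ x = 0 ↔ ∃ y, f * y = x
      rw [Ideal.Quotient.eq_zero_iff_mem, Ideal.mem_span_singleton]
      exact exists_congr fun _ ↦ eq_comm
  have hreg : (1 ⊗ₜ f : p.asIdeal.Fiber B) ∈ nonZeroDivisors (p.asIdeal.Fiber B) := by
    rw [mem_nonZeroDivisors_iff_left]
    intro x hx
    have hmul : (LinearMap.mulLeft A f).lTensor p.asIdeal.ResidueField =
        LinearMap.mulLeft A (1 ⊗ₜ f : p.asIdeal.Fiber B) := by
      ext; simp
    apply hinj
    rw [hmul, map_zero]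
    exact hx
  let e := PrimeSpectrum.preimageOrderIsoFiber A B p
  obtain ⟨Q, hQmin, hQ⟩ := Ideal.exists_minimalPrimes_le (I := ⊥) (J := (e ⟨q, hp.symm⟩).asIdeal)
    bot_le
  let Q' : PrimeSpectrum (p.asIdeal.Fiber B) := ⟨Q, hQmin.1.1⟩
  refine ⟨(e.symm Q').1, ?_, fun h ↦ ?_, (e.symm Q').2⟩
  · have : e.symm Q' ≤ ⟨q, hp.symm⟩ := by
      rw [OrderIso.symm_apply_le]
      exact hQ
    exact this
  · exact notMem_nonZeroDivisors_of_mem_mem_minimalPrimes (q := Q) h hQmin hreg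

/-- If `Z` is irreducible and not contained in `Z'`, then over a nonempty open subset of the base
every point of `Z ∩ Z'` has a generization outside of `Z'` in the same fiber of `Z`. -/
lemma RingHom.FiniteType.exists_prime_le_notMem_comap_eq {R B : Type u} [CommRing R] [CommRing B]
    [IsNoetherianRing R] {φ : R →+* B} (hφ : φ.FiniteType) {Z Z' : Set (PrimeSpectrum B)}
    (hZ : IsIrreducible Z) (hZc : IsClosed Z) (hZ' : IsClosed Z') (hZZ' : ¬ Z ⊆ Z') :
    ∃ a : R, ¬ IsNilpotent a ∧ ∀ q ∈ Z ∩ Z', a ∉ (PrimeSpectrum.comap φ q).asIdeal →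
      ∃ q' ∈ Z, q' ≤ q ∧ q' ∉ Z' ∧ PrimeSpectrum.comap φ q' = PrimeSpectrum.comap φ q := by
  obtain ⟨P, rfl⟩ : ∃ P : PrimeSpectrum B, Z = PrimeSpectrum.zeroLocus P.asIdeal := by
    obtain ⟨P, hP⟩ := QuasiSober.sober hZ hZc
    exact ⟨P, by rw [← hP.def, PrimeSpectrum.closure_singleton]⟩
  obtain ⟨I, rfl⟩ := (PrimeSpectrum.isClosed_iff_zeroLocus_ideal _).mp hZ'
  obtain ⟨f, hfI, hfP⟩ : ∃ f ∈ I, f ∉ P.asIdeal := by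
    by_contra! h
    exact hZZ' (PrimeSpectrum.zeroLocus_anti_mono h)
  let ψ : R →+* B ⧸ P.asIdeal := (Ideal.Quotient.mk _).comp φ
  have hψ : ψ.FiniteType := .comp_surjective hφ Ideal.Quotient.mk_surjective
  have hψ' : ψ.range.subtype.FiniteType := .of_comp_finiteType (f := ψ.rangeRestrict) hψ
  have : Algebra.FiniteType ψ.range (B ⧸ P.asIdeal) := hψ'
  obtain ⟨⟨_, a, rfl⟩, ha, H⟩ := Algebra.FiniteType.exists_prime_le_notMem_comap_eq (A := ψ.range)
    (f := Ideal.Quotient.mk P.asIdeal f)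
    (mem_nonZeroDivisors_of_ne_zero (by rwa [Ne, Ideal.Quotient.eq_zero_iff_mem]))
  have hψa : ψ a ≠ 0 := fun h ↦ ha (Subtype.ext h)
  refine ⟨a, fun h ↦ hψa (h.map ψ).eq_zero, fun q ⟨hqZ, hqZ'⟩ haq ↦ ?_⟩
  obtain ⟨q, rfl⟩ : ∃ q₀, PrimeSpectrum.comap (Ideal.Quotient.mk P.asIdeal) q₀ = q := by
    rw [← Set.mem_range, range_comap_of_surjective _ _ Ideal.Quotient.mk_surjective,
      Ideal.mk_ker]
    exact hqZ
  obtain ⟨q', hle, hfq', hq'⟩ := H q haq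
  refine ⟨PrimeSpectrum.comap (Ideal.Quotient.mk P.asIdeal) q', ?_, Ideal.comap_mono hle,
    fun h ↦ hfq' (h hfI), ?_⟩
  · intro x hx
    simp [Ideal.Quotient.eq_zero_iff_mem.mpr hx]
  · exact congrArg (PrimeSpectrum.comap ψ.rangeRestrict) hq'

/-- An irreducible component `C` of `Z ∩ f ⁻¹' {v}` has a generic point, which has no proper
generization in `Z ∩ f ⁻¹' {v}`. -/
lemma IsIrreducibleComponentOf.exists_mem_forall_specializes {X Y : Type*} [TopologicalSpace X]
    [TopologicalSpace Y] [QuasiSober X] [T0Space Y] {f : X → Y} (hf : Continuous f) {Z C : Set X}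
    (hZ : IsClosed Z) {v : Y} (hC : IsIrreducibleComponentOf C (Z ∩ f ⁻¹' {v})) :
    ∃ c ∈ C, ∀ c' ∈ Z ∩ f ⁻¹' {v}, c' ⤳ c → c ⤳ c' := by
  obtain ⟨⟨hCZ, hCirr⟩, hmax⟩ := hC
  have key (c : X) (hc : c ∈ Z ∩ f ⁻¹' {v}) (hCc : C ⊆ closure {c}) :
      closure {c} ∩ f ⁻¹' {v} ⊆ C := by
    refine hmax
      ⟨Set.inter_subset_inter_left _ (hZ.closure_subset_iff.mpr (by simpa using hc.1)), ?_⟩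
      fun x hx ↦ ⟨hCc hx, (hCZ hx).2⟩
    refine ⟨⟨c, subset_closure rfl, hc.2⟩, fun u u' hu hu' hcu hcu' ↦ ?_⟩
    have aux {w : Set X} (hw : IsOpen w) (h : (closure {c} ∩ f ⁻¹' {v} ∩ w).Nonempty) : c ∈ w := by
      obtain ⟨y, ⟨hy, -⟩, hyw⟩ := h
      exact (specializes_iff_mem_closure.mpr hy).mem_open hw hyw
    exact ⟨c, ⟨subset_closure rfl, hc.2⟩, aux hu hcu, aux hu' hcu'⟩
  obtain ⟨c, hc⟩ := QuasiSober.sober hCirr.closure isClosed_closure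
  have hcC : c ∈ closure C := hc.mem
  have hcZ : c ∈ Z := (hZ.closure_subset_iff.mpr fun x hx ↦ (hCZ hx).1) hcC
  have hcv : f c = v := by
    obtain ⟨x, hx⟩ := hCirr.nonempty
    have h₁ : f c ⤳ v := (hCZ hx).2 ▸ (hc.specializes (subset_closure hx)).map hf
    have h₂ : v ⤳ f c := by
      rw [specializes_iff_mem_closure]
      exact closure_mono (Set.image_subset_iff.mpr fun x hx ↦ (hCZ hx).2)
        (image_closure_subset_closure_image hf ⟨c, hcC, rfl⟩)
    exact (h₁.antisymm h₂).eq
  have hCc : C ⊆ closure {c} := by rw [hc.def]; exact subset_closure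
  refine ⟨c, key c ⟨hcZ, hcv⟩ hCc ⟨subset_closure rfl, hcv⟩, fun c' hc' hcc' ↦ ?_⟩
  have : c' ∈ C := key c' hc' (hCc.trans (closure_minimal (by simpa using hcc'.mem_closure)
    isClosed_closure)) ⟨subset_closure rfl, hc'.2⟩
  exact specializes_iff_mem_closure.mpr (hCc this)

/-- If `Z` is irreducible and not contained in `Z'`, then, locally on the source and over a nonempty
open subset of the base, every point of `Z ∩ Z'` has a generization outside of `Z'` in the same
fiber of `Z`. -/
lemma AlgebraicGeometry.exists_isOpen_forall_exists_specializes {D S : Scheme.{u}}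
    [IsLocallyNoetherian S] (g : D ⟶ S) [LocallyOfFiniteType g] {Z Z' : Set D}
    (hZ : IsIrreducible Z) (hZc : IsClosed Z) (hZ' : IsClosed Z') (hZZ' : ¬ Z ⊆ Z') (x : D) :
    ∃ W : Set D, IsOpen W ∧ x ∈ W ∧ ∃ V : Set S, IsOpen V ∧ V.Nonempty ∧
      ∀ c ∈ W ∩ (Z ∩ Z'), g c ∈ V → ∃ c' ∈ Z, c' ∉ Z' ∧ c' ⤳ c ∧ g c' = g c := by
  obtain ⟨_, ⟨U, hU, rfl⟩, hxU, -⟩ :=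
    S.isBasis_affineOpens.exists_subset_of_mem_open (Set.mem_univ (g x)) isOpen_univ
  obtain ⟨_, ⟨W, hW, rfl⟩, hxW, hWU⟩ :=
    D.isBasis_affineOpens.exists_subset_of_mem_open (show x ∈ g ⁻¹ᵁ U from hxU) (g ⁻¹ᵁ U).2
  replace hU : IsAffineOpen U := hU
  replace hW : IsAffineOpen W := hW
  refine ⟨W, W.2, hxW, ?_⟩
  by_cases hne : (Z ∩ W).Nonempty
  swap
  · exact ⟨Set.univ, isOpen_univ, ⟨g x, trivial⟩, fun c hc ↦ (hne ⟨c, hc.2.1, hc.1⟩).elim⟩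
  have : IsNoetherianRing Γ(S, U) := IsLocallyNoetherian.component_noetherian ⟨U, hU⟩
  set φ := g.appLE U W hWU
  have hφ (q : PrimeSpectrum Γ(D, W)) :
      hU.fromSpec (PrimeSpectrum.comap φ.hom q) = g (hW.fromSpec q) :=
    congrArg (fun f : Spec Γ(D, W) ⟶ S ↦ f q) (hU.SpecMap_appLE_fromSpec g hW hWU)
  have hWr : Set.range hW.fromSpec = (W : Set D) := hW.range_fromSpec
  have hemb : Topology.IsOpenEmbedding hW.fromSpec := hW.fromSpec.isOpenEmbedding
  have hembU : Topology.IsOpenEmbedding hU.fromSpec := hU.fromSpec.isOpenEmbedding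
  have hirr : IsIrreducible (hW.fromSpec ⁻¹' Z) :=
    ⟨by
      rw [Set.inter_comm, ← hWr] at hne
      obtain ⟨_, ⟨y, rfl⟩, hy⟩ := hne
      exact ⟨y, hy⟩, hZ.isPreirreducible.preimage hemb⟩
  have hnot : ¬ hW.fromSpec ⁻¹' Z ⊆ hW.fromSpec ⁻¹' Z' := by
    intro h
    refine hZZ' ?_
    refine (subset_closure_inter_of_isPreirreducible_of_isOpen hZ.isPreirreducible W.2 hne).trans
      (closure_minimal ?_ hZ')
    rintro z ⟨hzZ, hzW⟩
    obtain ⟨y, rfl⟩ : z ∈ Set.range hW.fromSpec := hWr ▸ hzW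
    exact h hzZ
  obtain ⟨a, ha, H⟩ := RingHom.FiniteType.exists_prime_le_notMem_comap_eq
    (g.finiteType_appLE hU hW hWU) hirr (hZc.preimage hemb.continuous)
    (hZ'.preimage hemb.continuous) hnot
  refine ⟨hU.fromSpec '' (PrimeSpectrum.basicOpen a : Set (PrimeSpectrum Γ(S, U))),
    hembU.isOpenMap _ (PrimeSpectrum.basicOpen a).2, ?_, ?_⟩
  · refine Set.Nonempty.image _ (Set.nonempty_iff_ne_empty.mpr fun h ↦ ?_)
    exact ha (PrimeSpectrum.basicOpen_eq_bot_iff a |>.mp (SetLike.coe_injective h))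
  · rintro c ⟨hcW, hcZ, hcZ'⟩ ⟨p, hpa, hpc⟩
    rw [← hWr] at hcW
    obtain ⟨q, rfl⟩ := hcW
    obtain rfl : PrimeSpectrum.comap φ.hom q = p := hembU.injective ((hφ q).trans hpc.symm)
    obtain ⟨q', hq'Z, hle, hq'Z', hq'⟩ := H q ⟨hcZ, hcZ'⟩ hpa
    refine ⟨hW.fromSpec q', hq'Z, hq'Z',
      ((PrimeSpectrum.le_iff_specializes _ _).mp hle).map hemb.continuous, ?_⟩
    exact (hφ q').symm.trans ((congrArg _ hq').trans hpc)

/-- Let `S` be an irreducible noetherian scheme, `g : D → S` a morphism of finite type and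
`{D_i}` the set of irreducible components of `D`.  Assume that for each `i` the restriction
of `g` to `D_i` is surjective.  Then there is a dense open subset `V ⊆ S` such that for every
point `v ∈ V` and all distinct irreducible components `D_i ≠ D_j`, the fibers `D_{i,v}` and
`D_{j,v}` have no common irreducible component. -/
theorem exists_dense_open_fibers_of_components_share_no_irreducible_component
    {D S : Scheme} [IrreducibleSpace S] [IsNoetherian S]
    (g : D ⟶ S) [LocallyOfFiniteType g] [QuasiCompact g]
    (hsurj : ∀ Z ∈ irreducibleComponents D, Set.SurjOn g.base Z Set.univ) :
    ∃ V : Set S, IsOpen V ∧ Dense V ∧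
      ∀ v ∈ V, ∀ Zi ∈ irreducibleComponents D, ∀ Zj ∈ irreducibleComponents D, Zi ≠ Zj →
        ¬ ∃ C : Set D,
            IsIrreducibleComponentOf C (Zi ∩ g.base ⁻¹' {v}) ∧
            IsIrreducibleComponentOf C (Zj ∩ g.base ⁻¹' {v}) := by
  have : IsNoetherian D := by
    have := LocallyOfFiniteType.isLocallyNoetherian g
    have := QuasiCompact.compactSpace_of_compactSpace g
    exact ⟨⟩
  have hfin := TopologicalSpace.NoetherianSpace.finite_irreducibleComponents (α := D)
  have hdense : ∀ Zi ∈ irreducibleComponents D, ∀ Zj ∈ irreducibleComponents D, Zi ≠ Zj →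
      ∃ V : Set S, IsOpen V ∧ Dense V ∧ ∀ c ∈ Zi ∩ Zj, g c ∈ V →
        ∃ c' ∈ Zi, c' ∉ Zj ∧ c' ⤳ c ∧ g c' = g c := by
    intro Zi hi Zj hj hij
    have hij' : ¬ Zi ⊆ Zj := fun h ↦ hij (h.antisymm (hi.2 hj.1 h))
    choose W hW hxW V hV hVne H using exists_isOpen_forall_exists_specializes g hi.1
      (isClosed_of_mem_irreducibleComponents Zi hi) (isClosed_of_mem_irreducibleComponents Zj hj)
      hij'
    obtain ⟨t, ht⟩ := isCompact_univ.elim_finite_subcover W hW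
      fun x _ ↦ Set.mem_iUnion.mpr ⟨x, hxW x⟩
    refine ⟨⋂ x ∈ t, V x, isOpen_biInter_finset fun x _ ↦ hV x, ?_, fun c hc hcV ↦ ?_⟩
    · rw [← t.set_biInter_coe, ← Set.sInter_image]
      exact (t.finite_toSet.image V).dense_sInter (Set.forall_mem_image.mpr fun x _ ↦ hV x)
        (Set.forall_mem_image.mpr fun x _ ↦ (hV x).dense (hVne x))
    · obtain ⟨x, hx, hcx⟩ := Set.mem_iUnion₂.mp (ht (Set.mem_univ c))
      exact H x c ⟨hcx, hc⟩ (Set.mem_iInter₂.mp hcV x hx)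
  choose! V hVo hVd hV using hdense
  let I : Set (Set D × Set D) :=
    {p | p ∈ irreducibleComponents D ×ˢ irreducibleComponents D ∧ p.1 ≠ p.2}
  have hI : I.Finite := (hfin.prod hfin).subset fun p hp ↦ hp.1
  refine ⟨⋂ p ∈ I, V p.1 p.2, hI.isOpen_biInter fun p hp ↦ hVo _ hp.1.1 _ hp.1.2 hp.2, ?_, ?_⟩
  · rw [← Set.sInter_image (fun p ↦ V p.1 p.2) I]
    exact (hI.image _).dense_sInter
      (Set.forall_mem_image.mpr fun p hp ↦ hVo _ hp.1.1 _ hp.1.2 hp.2)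
      (Set.forall_mem_image.mpr fun p hp ↦ hVd _ hp.1.1 _ hp.1.2 hp.2)
  · rintro v hv Zi hi Zj hj hij ⟨C, hCi, hCj⟩
    obtain ⟨c, hcC, hc⟩ := hCi.exists_mem_forall_specializes g.continuous
      (isClosed_of_mem_irreducibleComponents Zi hi)
    obtain ⟨hcZi, hcv⟩ := hCi.1.1 hcC
    obtain rfl : g c = v := hcv
    obtain ⟨c', hc'i, hc'j, hc'c, hgc⟩ := hV Zi hi Zj hj hij c ⟨hcZi, (hCj.1.1 hcC).1⟩
      (Set.mem_iInter₂.mp hv (Zi, Zj) ⟨⟨hi, hj⟩, hij⟩)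
    exact hc'j ((hc c' ⟨hc'i, hgc⟩ hc'c).mem_closed (isClosed_of_mem_irreducibleComponents Zj hj)
      (hCj.1.1 hcC).1)
end
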